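/- Let S = ((X,d),(f_i)_{i∈I}) be an IFS. The following are equivalent: (1) there exist a comparison function φ and a metric d₁ on X, topologically equivalent to d and with (X,d₁) complete, such that every f_i is a φ-contraction with respect to d₁ (S is hyperbolic φ-contractive for some φ); (4) there exists a metric d₁ on X, topologically equivalent to d and with (X,d₁) complete, such that ((X,d₁),(f_i)_{i∈I}) is a diameter diminishing to zero IFS. -/

import Mathlib

open Metric Set Filter Bornology

/-- Composition of the maps of an IFS along a finite word:
`wordComp f [i₁,…,iₙ] = f i₁ ∘ … ∘ f iₙ`. -/
def wordComp {I X : Type*} (f : I → X → X) : List I → X → X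
  | [] => id
  | i :: l => f i ∘ wordComp f l

/-- The prefix `[ω]_n` of length `n` of an infinite word `ω ∈ Λ(I) = I^ℕ`. -/
def prefixList {I : Type*} (ω : ℕ → I) (n : ℕ) : List I :=
  List.ofFn fun k : Fin n => ω k

/-- The fractal operator of an IFS: `F_S(B)` is the closure of `⋃ i, f_i(B)`. -/
def fractalOp {I X : Type*} [MetricSpace X] (f : I → X → X) (B : Set X) : Set X :=
  closure (⋃ i, f i '' B)

/-- The IFS `(f_i)_{i ∈ I}` on `X` is diameter diminishing to zero: every nonempty bounded
closed `B` is contained in a nonempty bounded closed `M_B` invariant under the fractal operator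
with `max_{ω ∈ Iⁿ} diam (f_ω(M_B)) → 0`. -/
def IsDDZ {X I : Type*} [MetricSpace X] (f : I → X → X) : Prop :=
  ∀ B : Set X, B.Nonempty → IsBounded B → IsClosed B →
    ∃ M : Set X, M.Nonempty ∧ IsBounded M ∧ IsClosed M ∧ B ⊆ M ∧
      fractalOp f M ⊆ M ∧
      Tendsto (fun n : ℕ => ⨆ ω : Fin n → I, diam (wordComp f (List.ofFn ω) '' M))
        atTop (nhds 0)

/-- `φ : [0,∞) → [0,∞)` is a comparison function: increasing, `φ(t) < t` for `t > 0`, and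
right-continuous. -/
def IsComparisonFn (φ : ℝ → ℝ) : Prop :=
  (∀ t : ℝ, 0 ≤ t → 0 ≤ φ t) ∧ MonotoneOn φ (Set.Ici 0) ∧ (∀ t : ℝ, 0 < t → φ t < t) ∧
    ∀ t : ℝ, 0 ≤ t → ContinuousWithinAt φ (Set.Ici t) t

/-- Every map of the system sends bounded sets to bounded sets (condition iv) of the
definition of an IFS). -/
def BoundedPreserving {X I : Type*} [MetricSpace X] (f : I → X → X) : Prop :=
  ∀ i (B : Set X), IsBounded B → IsBounded (f i '' B)

/-- Every map of the system is a `φ`-contraction. -/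
def IsPhiContractive {X I : Type*} [MetricSpace X] (φ : ℝ → ℝ) (f : I → X → X) : Prop :=
  ∀ (i : I) (x y : X), dist (f i x) (f i y) ≤ φ (dist x y)

open Topology

theorem wordComp_append {I X : Type*} (f : I → X → X) (v w : List I) (x : X) :
    wordComp f (v ++ w) x = wordComp f v (wordComp f w x) := by
  induction v with
  | nil => rfl
  | cons i v ih => exact congrArg (f i) ih

theorem wordComp_concat {I X : Type*} (f : I → X → X) (v : List I) (i : I) (x : X) :
    wordComp f (v ++ [i]) x = wordComp f v (f i x) :=
  wordComp_append f v [i] x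

theorem continuous_wordComp {I X : Type*} [TopologicalSpace X] {f : I → X → X}
    (hf : ∀ i, Continuous (f i)) (w : List I) : Continuous (wordComp f w) := by
  induction w with
  | nil => exact continuous_id
  | cons i w ih => exact (hf i).comp ih

theorem mapsTo_wordComp {I X : Type*} {f : I → X → X} {M : Set X}
    (hM : ∀ i, MapsTo (f i) M M) (w : List I) : MapsTo (wordComp f w) M M := by
  induction w with
  | nil => exact mapsTo_id M
  | cons i w ih => exact (hM i).comp ih

namespace IsComparisonFn

variable {φ : ℝ → ℝ}

theorem le_self (hφ : IsComparisonFn φ) {t : ℝ} (ht : 0 ≤ t) : φ t ≤ t := by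
  refine le_of_forall_gt fun c hc => ?_
  exact (hφ.2.1 ht (ht.trans hc.le) hc.le).trans_lt (hφ.2.2.1 c (ht.trans_lt hc))

theorem iterate_nonneg (hφ : IsComparisonFn φ) {t : ℝ} (ht : 0 ≤ t) (n : ℕ) :
    0 ≤ φ^[n] t := by
  induction n with
  | zero => exact ht
  | succ n ih => rw [Function.iterate_succ_apply']; exact hφ.1 _ ih

theorem iterate_mono (hφ : IsComparisonFn φ) {s t : ℝ} (hs : 0 ≤ s) (hst : s ≤ t) (n : ℕ) :
    φ^[n] s ≤ φ^[n] t := by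
  induction n with
  | zero => exact hst
  | succ n ih =>
    rw [Function.iterate_succ_apply', Function.iterate_succ_apply']
    exact hφ.2.1 (hφ.iterate_nonneg hs n) (hφ.iterate_nonneg (hs.trans hst) n) ih

theorem tendsto_iterate (hφ : IsComparisonFn φ) {t : ℝ} (ht : 0 ≤ t) :
    Tendsto (fun n => φ^[n] t) atTop (𝓝 0) := by
  have hanti : Antitone fun n => φ^[n] t := antitone_nat_of_succ_le fun n => by
    rw [Function.iterate_succ_apply']
    exact hφ.le_self (hφ.iterate_nonneg ht n)
  have hbdd : BddBelow (range fun n => φ^[n] t) :=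
    ⟨0, by rintro _ ⟨n, rfl⟩; exact hφ.iterate_nonneg ht n⟩
  have hlim := tendsto_atTop_ciInf hanti hbdd
  set L := ⨅ n, φ^[n] t
  have hL : 0 ≤ L := le_ciInf fun n => hφ.iterate_nonneg ht n
  have hwithin : Tendsto (fun n => φ^[n] t) atTop (𝓝[Ici L] L) :=
    tendsto_nhdsWithin_iff.2 ⟨hlim, Eventually.of_forall fun n => ciInf_le hbdd n⟩
  have h₁ : Tendsto (fun n => φ (φ^[n] t)) atTop (𝓝 (φ L)) :=
    (hφ.2.2.2 L hL).tendsto.comp hwithin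
  have h₂ : Tendsto (fun n => φ (φ^[n] t)) atTop (𝓝 L) := by
    simpa only [Function.comp_def, Function.iterate_succ_apply'] using
      hlim.comp (tendsto_add_atTop_nat 1)
  have hfix : φ L = L := tendsto_nhds_unique h₁ h₂
  have hL0 : L = 0 := by
    by_contra hne
    exact (hφ.2.2.1 L (lt_of_le_of_ne hL (Ne.symm hne))).ne hfix
  rwa [hL0] at hlim

end IsComparisonFn

namespace IsPhiContractive

variable {X I : Type*} [MetricSpace X] {φ : ℝ → ℝ} {f : I → X → X}

theorem dist_le (hφ : IsComparisonFn φ) (hf : IsPhiContractive φ f) (i : I) (x y : X) :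
    dist (f i x) (f i y) ≤ dist x y :=
  (hf i x y).trans (hφ.le_self dist_nonneg)

theorem boundedPreserving (hφ : IsComparisonFn φ) (hf : IsPhiContractive φ f) :
    BoundedPreserving f := by
  intro i B hB
  obtain ⟨C, hC⟩ := isBounded_iff.1 hB
  refine isBounded_iff.2 ⟨C, ?_⟩
  rintro _ ⟨x, hx, rfl⟩ _ ⟨y, hy, rfl⟩
  exact (hf.dist_le hφ i x y).trans (hC hx hy)

theorem dist_wordComp_le (hφ : IsComparisonFn φ) (hf : IsPhiContractive φ f) (w : List I)
    (x y : X) : dist (wordComp f w x) (wordComp f w y) ≤ φ^[w.length] (dist x y) := by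
  induction w with
  | nil => exact le_rfl
  | cons i w ih =>
    rw [List.length_cons, Function.iterate_succ_apply']
    exact (hf i _ _).trans
      (hφ.2.1 dist_nonneg (hφ.iterate_nonneg dist_nonneg _) ih)

/-- The orbit of a point under all finite compositions is bounded. -/
theorem exists_dist_orbit_le [Finite I] (hφ : IsComparisonFn φ) (hf : IsPhiContractive φ f)
    (x₀ : X) : ∃ R, ∀ w : List I, dist (wordComp f w x₀) x₀ ≤ R := by
  obtain ⟨C, hC⟩ : ∃ C, ∀ i, dist (f i x₀) x₀ ≤ C := Finite.exists_le _
  have hC' : 0 ≤ max C 0 := le_max_right _ _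
  obtain ⟨N, hN⟩ := ((hφ.tendsto_iterate hC').eventually
    (gt_mem_nhds (sub_pos.2 (hφ.2.2.1 1 one_pos)))).exists
  have key : ∀ w : List I, N ≤ w.length → ∃ z : List I, z.length = N ∧
      dist (wordComp f w x₀) (wordComp f z x₀) ≤ 1 := by
    intro w
    induction w with
    | nil => intro h; exact ⟨[], (Nat.le_zero.1 h).symm, by simp⟩
    | cons i w ih =>
      intro h
      rcases Nat.lt_or_ge w.length N with hlt | hge
      · exact ⟨i :: w, le_antisymm hlt h, by simp⟩
      obtain ⟨z, hz, hd⟩ := ih hge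
      obtain hnil | ⟨v, j, hv⟩ := List.eq_nil_or_concat (i :: z)
      · simp at hnil
      have hlen : v.length = N := by
        have := congrArg List.length hv
        simp at this
        omega
      refine ⟨v, hlen, ?_⟩
      have h₁ : dist (wordComp f (i :: w) x₀) (wordComp f (i :: z) x₀) ≤ φ 1 :=
        (hf i _ _).trans (hφ.2.1 dist_nonneg (zero_le_one' ℝ) hd)
      have h₂ : dist (wordComp f (i :: z) x₀) (wordComp f v x₀) ≤ 1 - φ 1 := by
        rw [hv, List.concat_eq_append, wordComp_concat]
        refine (hf.dist_wordComp_le hφ v _ _).trans (le_trans ?_ hN.le)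
        rw [hlen]
        exact hφ.iterate_mono dist_nonneg ((hC j).trans (le_max_left _ _)) N
      linarith [dist_triangle (wordComp f (i :: w) x₀) (wordComp f (i :: z) x₀)
        (wordComp f v x₀)]
  obtain ⟨R, hR⟩ := ((List.finite_length_le I N).image
    fun w => dist (wordComp f w x₀) x₀).bddAbove
  refine ⟨1 + R, fun w => ?_⟩
  rcases le_total w.length N with hw | hw
  · linarith [hR (mem_image_of_mem _ hw)]
  · obtain ⟨z, hz, hd⟩ := key w hw
    linarith [hR (mem_image_of_mem _ hz.le), dist_triangle (wordComp f w x₀)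
      (wordComp f z x₀) x₀]

theorem isDDZ [Finite I] (hφ : IsComparisonFn φ) (hf : IsPhiContractive φ f) : IsDDZ f := by
  rintro B ⟨x₀, hx₀⟩ hB -
  obtain ⟨R, hR⟩ := hf.exists_dist_orbit_le hφ x₀
  obtain ⟨r, hr⟩ := isBounded_iff.1 hB
  have hr0 : 0 ≤ r := dist_nonneg.trans (hr hx₀ hx₀)
  set O : Set X := range fun w : List I => wordComp f w x₀
  have hx₀O : x₀ ∈ O := ⟨[], rfl⟩
  have hO : O.Nonempty := ⟨x₀, hx₀O⟩
  set M : Set X := {x | infDist x O ≤ r}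
  have hdist : ∀ x ∈ M, dist x x₀ ≤ r + 1 + R := by
    intro x hx
    obtain ⟨_, ⟨w, rfl⟩, hw⟩ :=
      (infDist_lt_iff hO).1 (lt_of_le_of_lt (show infDist x O ≤ r from hx) (lt_add_one r))
    have := dist_triangle x (wordComp f w x₀) x₀
    have := hR w
    simp only at hw
    linarith
  have hBM : B ⊆ M := fun x hx => (infDist_le_dist_of_mem hx₀O).trans (hr hx hx₀)
  have hclosed : IsClosed M := isClosed_le (continuous_infDist_pt O) continuous_const
  have hmaps : ∀ i, MapsTo (f i) M M := by
    intro i x hx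
    refine le_of_forall_gt (α := ℝ) fun c hc => ?_
    obtain ⟨_, ⟨w, rfl⟩, hw⟩ := (infDist_lt_iff hO).1 (lt_of_le_of_lt hx hc)
    have hmem : f i (wordComp f w x₀) ∈ O := ⟨i :: w, rfl⟩
    exact (infDist_le_dist_of_mem hmem).trans_lt
      ((hf.dist_le hφ i _ _).trans_lt hw)
  have hC : ∀ x ∈ M, ∀ y ∈ M, dist x y ≤ 2 * (r + 1 + R) := by
    intro x hx y hy
    linarith [dist_triangle_right x y x₀, hdist x hx, hdist y hy]
  have hC0 : 0 ≤ 2 * (r + 1 + R) := dist_nonneg.trans (hC x₀ (hBM hx₀) x₀ (hBM hx₀))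
  refine ⟨M, ⟨x₀, hBM hx₀⟩, isBounded_iff.2 ⟨_, fun x hx y hy => hC x hx y hy⟩, hclosed, hBM,
    closure_minimal (iUnion_subset fun i => (hmaps i).image_subset) hclosed, ?_⟩
  refine squeeze_zero (fun n => Real.iSup_nonneg fun _ => diam_nonneg) (fun n => ?_)
    (hφ.tendsto_iterate hC0)
  refine Real.iSup_le (fun ω => ?_) (hφ.iterate_nonneg hC0 n)
  refine diam_le_of_forall_dist_le (hφ.iterate_nonneg hC0 n) ?_
  rintro _ ⟨x, hx, rfl⟩ _ ⟨y, hy, rfl⟩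
  refine (hf.dist_wordComp_le hφ _ x y).trans ?_
  rw [List.length_ofFn]
  exact hφ.iterate_mono dist_nonneg (hC x hx y hy) n

end IsPhiContractive

/-- A uniform Meir–Keeler type condition produces a comparison function. -/
theorem exists_isComparisonFn {X I : Type*} [MetricSpace X] {f : I → X → X}
    (h : ∀ s > 0, ∃ s' > s, ∃ r < s, ∀ x y i, dist x y < s' → dist (f i x) (f i y) ≤ r) :
    ∃ φ, IsComparisonFn φ ∧ IsPhiContractive φ f := by
  set R : ℝ → Set ℝ := fun s =>
    {r | 0 ≤ r ∧ ∃ s' > s, ∀ x y i, dist x y < s' → dist (f i x) (f i y) ≤ r}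
  have hanti : ∀ s t, s ≤ t → R t ⊆ R s := fun s t hst r ⟨hr, s', hs', H⟩ =>
    ⟨hr, s', hst.trans_lt hs', H⟩
  have hlt : ∀ s > 0, ∃ r ∈ R s, r < s := by
    intro s hs
    obtain ⟨s', hs', r, hr, H⟩ := h s hs
    exact ⟨max r 0, ⟨le_max_right _ _, s', hs', fun x y i hxy =>
      (H x y i hxy).trans (le_max_left _ _)⟩, max_lt hr hs⟩
  have hne : ∀ s, (R s).Nonempty := by
    intro s
    obtain ⟨r, hr, -⟩ := hlt (max s 1) (lt_max_of_lt_right one_pos)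
    exact ⟨r, hanti _ _ (le_max_left _ _) hr⟩
  have hbdd : ∀ s, BddBelow (R s) := fun s => ⟨0, fun r hr => hr.1⟩
  have hmono : ∀ s t, s ≤ t → sInf (R s) ≤ sInf (R t) := fun s t hst =>
    csInf_le_csInf (hbdd s) (hne t) (hanti s t hst)
  refine ⟨fun s => sInf (R s), ⟨fun s _ => le_csInf (hne s) fun r hr => hr.1,
    fun s _ t _ hst => hmono s t hst, fun s hs => ?_, fun s _ => ?_⟩, fun i x y => ?_⟩
  · obtain ⟨r, hr, hrs⟩ := hlt s hs
    exact (csInf_le (hbdd s) hr).trans_lt hrs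
  · refine tendsto_order.2 ⟨fun c hc => ?_, fun c hc => ?_⟩
    · filter_upwards [self_mem_nhdsWithin] with u hu
      exact hc.trans_le (hmono s u hu)
    · obtain ⟨r, ⟨hr, s', hs', H⟩, hrc⟩ := (csInf_lt_iff (hbdd s) (hne s)).1 hc
      filter_upwards [mem_nhdsWithin_of_mem_nhds (Iio_mem_nhds hs')] with u hu
      exact (csInf_le (hbdd u) ⟨hr, s', hu, H⟩).trans_lt hrc
  · refine le_csInf (hne _) ?_
    rintro r ⟨-, s', hs', H⟩
    exact H x y i hs'

/-- Every set bounded for `δ` lies in an invariant set bounded for `δ` on which long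
compositions have uniformly small oscillation for `δ`. -/
def UniformlyDiminishing {X I : Type*} (δ : X → X → ℝ) (f : I → X → X) : Prop :=
  ∀ B : Set X, (∃ C, ∀ x ∈ B, ∀ y ∈ B, δ x y ≤ C) →
    ∃ M : Set X, B ⊆ M ∧ (∃ C, ∀ x ∈ M, ∀ y ∈ M, δ x y ≤ C) ∧ (∀ i, MapsTo (f i) M M) ∧
      ∀ ε > 0, ∃ N : ℕ, ∀ w : List I, N ≤ w.length → ∀ x ∈ M, ∀ y ∈ M,
        δ (wordComp f w x) (wordComp f w y) ≤ ε

theorem IsDDZ.uniformlyDiminishing {X I : Type*} [MetricSpace X] [Finite I] {f : I → X → X}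
    (hf : IsDDZ f) : UniformlyDiminishing dist f := by
  rintro B ⟨C, hC⟩
  rcases B.eq_empty_or_nonempty with rfl | hB
  · exact ⟨∅, Subset.rfl, ⟨0, by simp⟩, fun i => mapsTo_empty _ _, fun ε _ => ⟨0, by simp⟩⟩
  obtain ⟨M, -, hMb, -, hBM, hinv, hlim⟩ := hf (closure B) hB.closure
    (isBounded_iff.2 ⟨C, fun x hx y hy => hC x hx y hy⟩).closure isClosed_closure
  have hmaps : ∀ i, MapsTo (f i) M M := fun i x hx =>
    hinv (subset_closure (mem_iUnion.2 ⟨i, mem_image_of_mem _ hx⟩))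
  refine ⟨M, subset_closure.trans hBM, ?_, hmaps, fun ε hε => ?_⟩
  · obtain ⟨C', hC'⟩ := isBounded_iff.1 hMb
    exact ⟨C', fun x hx y hy => hC' hx hy⟩
  obtain ⟨N, hN⟩ := eventually_atTop.1 (hlim.eventually (gt_mem_nhds hε))
  refine ⟨N, fun w hw x hx y hy => le_trans ?_ (hN w.length hw).le⟩
  have hw' : List.ofFn w.get = w := List.ofFn_get w
  calc dist (wordComp f w x) (wordComp f w y)
      ≤ diam (wordComp f w '' M) :=
        dist_le_diam_of_mem (hMb.subset (mapsTo_wordComp hmaps w).image_subset)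
          (mem_image_of_mem _ hx) (mem_image_of_mem _ hy)
    _ = diam (wordComp f (List.ofFn w.get) '' M) := by rw [hw']
    _ ≤ _ := le_ciSup (f := fun ω : Fin w.length → I => diam (wordComp f (List.ofFn ω) '' M))
        (Set.finite_range _).bddAbove w.get

/-- Taking the supremum over all words of pseudodistances `D n` of the images under words of
length `n` yields a complete metric inducing the original topology. -/
theorem exists_metricSpace_iSup {X I : Type*} [m : MetricSpace X] [CompleteSpace X] [Finite I]
    {f : I → X → X} (hf : ∀ i, Continuous (f i)) (D : ℕ → X → X → ℝ)
    (hself : ∀ n x, D n x x = 0) (hsymm : ∀ n x y, D n x y = D n y x)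
    (htri : ∀ n x y z, D n x z ≤ D n x y + D n y z) (hdist : ∀ x y, dist x y ≤ D 0 x y)
    (hcont : ∀ n x, Tendsto (D n x) (𝓝 x) (𝓝 0))
    (htail : ∀ B : Set X, IsBounded B → ∀ ε > 0, ∃ N : ℕ, ∀ w : List I, N ≤ w.length →
      ∀ x ∈ B, ∀ y ∈ B, D w.length (wordComp f w x) (wordComp f w y) ≤ ε) :
    ∃ m₁ : MetricSpace X,
      m₁.toUniformSpace.toTopologicalSpace = m.toUniformSpace.toTopologicalSpace ∧
      @CompleteSpace X m₁.toUniformSpace ∧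
      (∀ x y, m.dist x y ≤ m₁.dist x y) ∧
      (∀ w x y, D w.length (wordComp f w x) (wordComp f w y) ≤ m₁.dist x y) ∧
      ∀ x y c, (∀ w, D w.length (wordComp f w x) (wordComp f w y) ≤ c) → m₁.dist x y ≤ c := by
  set T : X → X → List I → ℝ := fun x y w => D w.length (wordComp f w x) (wordComp f w y)
  have hbdd : ∀ x y, BddAbove (range (T x y)) := by
    intro x y
    obtain ⟨N, hN⟩ := htail {x, y} (Set.toFinite _).isBounded 1 one_pos
    obtain ⟨C, hC⟩ := ((List.finite_length_lt I N).image (T x y)).bddAbove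
    refine ⟨max C 1, ?_⟩
    rintro _ ⟨w, rfl⟩
    rcases lt_or_ge w.length N with hw | hw
    · exact (hC (mem_image_of_mem _ hw)).trans (le_max_left _ _)
    · exact (hN w hw x (by simp) y (by simp)).trans (le_max_right _ _)
  set S : X → X → ℝ := fun x y => ⨆ w, T x y w
  have hTS : ∀ x y w, T x y w ≤ S x y := fun x y w => le_ciSup (hbdd x y) w
  have hS : ∀ x y c, (∀ w, T x y w ≤ c) → S x y ≤ c := fun x y c h => ciSup_le h
  have hdS : ∀ x y, dist x y ≤ S x y := fun x y => (hdist x y).trans (hTS x y [])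
  have hScont : ∀ x, ∀ ε > 0, ∀ᶠ y in 𝓝 x, S x y < ε := by
    intro x ε hε
    obtain ⟨N, hN⟩ := htail (ball x 1) isBounded_ball (ε / 2) (half_pos hε)
    have hshort : ∀ᶠ y in 𝓝 x, ∀ w ∈ {w : List I | w.length < N}, T x y w < ε / 2 := by
      refine (eventually_all_finite (List.finite_length_lt I N)).2 fun w _ => ?_
      exact ((hcont w.length (wordComp f w x)).comp
        (continuous_wordComp hf w).continuousAt).eventually (gt_mem_nhds (half_pos hε))
    filter_upwards [hshort, ball_mem_nhds x one_pos] with y hy hyx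
    refine (hS x y (ε / 2) fun w => ?_).trans_lt (half_lt_self hε)
    rcases lt_or_ge w.length N with hw | hw
    · exact (hy w hw).le
    · exact hN w hw x (mem_ball_self one_pos) y hyx
  have hlim : ∀ u : ℕ → X, (∀ ε > 0, ∃ N, ∀ k ≥ N, ∀ l ≥ N, S (u k) (u l) < ε) →
      ∃ a, Tendsto u atTop (𝓝 a) := fun u hu =>
    cauchySeq_tendsto_of_complete <| Metric.cauchySeq_iff.2 fun ε hε => by
      obtain ⟨N, hN⟩ := hu ε hε
      exact ⟨N, fun k hk l hl => (hdS _ _).trans_lt (hN k hk l hl)⟩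
  let m₁ : MetricSpace X := MetricSpace.ofDistTopology S
    (fun x => by simp [S, T, hself])
    (fun x y => congrArg iSup (funext fun w => hsymm _ _ _))
    (fun x y z => hS x z _ fun w =>
      (htri _ _ (wordComp f w y) _).trans (add_le_add (hTS x y w) (hTS y z w)))
    (fun s => by
      refine ⟨fun hs x hx => ?_, fun h => isOpen_iff_mem_nhds.2 fun x hx => ?_⟩
      · obtain ⟨ε, hε, hsub⟩ := Metric.isOpen_iff.1 hs x hx
        exact ⟨ε, hε, fun y hy => hsub (mem_ball'.2 ((hdS x y).trans_lt hy))⟩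
      · obtain ⟨ε, hε, hsub⟩ := h x hx
        exact mem_of_superset (hScont x ε hε) fun y hy => hsub y hy)
    (fun x y h => dist_le_zero.1 ((hdS x y).trans h.le))
  refine ⟨m₁, rfl, ?_, hdS, fun w x y => hTS x y w, hS⟩
  refine @Metric.complete_of_cauchySeq_tendsto X m₁.toPseudoMetricSpace fun u hu => ?_
  exact hlim u ((@Metric.cauchySeq_iff X ℕ m₁.toPseudoMetricSpace _ _ u).1 hu)

theorem UniformlyDiminishing.exists_nonexpansive {X I : Type*} [m : MetricSpace X]
    [CompleteSpace X] [Finite I] {f : I → X → X} (hcont : ∀ i, Continuous (f i))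
    (hf : UniformlyDiminishing dist f) :
    ∃ m₁ : MetricSpace X,
      m₁.toUniformSpace.toTopologicalSpace = m.toUniformSpace.toTopologicalSpace ∧
      @CompleteSpace X m₁.toUniformSpace ∧
      UniformlyDiminishing m₁.dist f ∧ ∀ i x y, m₁.dist (f i x) (f i y) ≤ m₁.dist x y := by
  obtain ⟨m₁, htop, hcomplete, hdist, hle, hsup⟩ :=
    exists_metricSpace_iSup hcont (fun _ => dist) (fun _ => dist_self) (fun _ => dist_comm)
      (fun _ => dist_triangle) (fun _ _ => le_rfl)
      (fun _ x => by simpa using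
        (continuous_const.dist continuous_id).tendsto (f := fun y => dist x y) x)
      (fun B hB ε hε => by
        obtain ⟨C, hC⟩ := isBounded_iff.1 hB
        obtain ⟨M, hBM, -, -, hM⟩ := hf B ⟨C, fun x hx y hy => hC hx hy⟩
        obtain ⟨N, hN⟩ := hM ε hε
        exact ⟨N, fun w hw x hx y hy => hN w hw x (hBM hx) y (hBM hy)⟩)
  refine ⟨m₁, htop, hcomplete, ?_, fun i x y => hsup _ _ _ fun w => ?_⟩
  · rintro B ⟨C, hC⟩
    obtain ⟨M, hBM, ⟨C', hC'⟩, hmaps, hM⟩ :=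
      hf B ⟨C, fun x hx y hy => (hdist x y).trans (hC x hx y hy)⟩
    refine ⟨M, hBM, ⟨C', fun x hx y hy => hsup _ _ _ fun w => hC' _
      (mapsTo_wordComp hmaps w hx) _ (mapsTo_wordComp hmaps w hy)⟩, hmaps, fun ε hε => ?_⟩
    obtain ⟨N, hN⟩ := hM ε hε
    refine ⟨N, fun w hw x hx y hy => hsup _ _ _ fun v => ?_⟩
    rw [← wordComp_append, ← wordComp_append]
    exact hN _ (by rw [List.length_append]; omega) x hx y hy
  · rw [← wordComp_concat, ← wordComp_concat]
    exact hle (w ++ [i]) x y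

theorem dist_wordComp_le_of_nonexpansive {X I : Type*} [MetricSpace X] {f : I → X → X}
    (hne : ∀ i x y, dist (f i x) (f i y) ≤ dist x y) (w : List I) (x y : X) :
    dist (wordComp f w x) (wordComp f w y) ≤ dist x y := by
  induction w with
  | nil => exact le_rfl
  | cons i w ih => exact (hne i _ _).trans ih

/-- The pseudodistance of the quotient collapsing the zero set of a `1`-Lipschitz function. -/
theorem min_dist_add_triangle {X : Type*} [MetricSpace X] {g : X → ℝ} (hg0 : ∀ x, 0 ≤ g x)
    (hg : ∀ x y, g x ≤ g y + dist x y) (x y z : X) :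
    min (dist x z) (g x + g z) ≤ min (dist x y) (g x + g y) + min (dist y z) (g y + g z) := by
  have h₁ := dist_triangle x y z
  have h₂ := hg x y
  have h₃ := hg z y
  have h₄ := hg0 y
  rw [dist_comm z y] at h₃
  rcases min_cases (dist x y) (g x + g y) with ⟨e, -⟩ | ⟨e, -⟩ <;>
  rcases min_cases (dist y z) (g y + g z) with ⟨e', -⟩ | ⟨e', -⟩ <;> rw [e, e']
  · exact (min_le_left _ _).trans h₁
  all_goals exact (min_le_right _ _).trans (by linarith)

theorem UniformlyDiminishing.exists_contractive {X I : Type*} [m : MetricSpace X]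
    [CompleteSpace X] [Finite I] {f : I → X → X} (hf : UniformlyDiminishing dist f)
    (hne : ∀ i x y, dist (f i x) (f i y) ≤ dist x y) :
    ∃ m₁ : MetricSpace X,
      m₁.toUniformSpace.toTopologicalSpace = m.toUniformSpace.toTopologicalSpace ∧
      @CompleteSpace X m₁.toUniformSpace ∧
      ∀ s > 0, ∃ s' > s, ∃ r < s, ∀ x y i, m₁.dist x y < s' → m₁.dist (f i x) (f i y) ≤ r := by
  rcases isEmpty_or_nonempty X with hX | ⟨⟨x₀⟩⟩
  · exact ⟨m, rfl, ‹_›, fun s hs => ⟨s + 1, lt_add_one s, 0, hs, fun x => hX.elim x⟩⟩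
  have hcont : ∀ i, Continuous (f i) := fun i => by
    refine (LipschitzWith.of_dist_le_mul (K := 1) fun x y => ?_).continuous
    simpa using hne i x y
  obtain ⟨M₀, hx₀, ⟨R, hR⟩, hM₀, -⟩ := hf {x₀} ⟨0, by simp⟩
  replace hx₀ : x₀ ∈ M₀ := hx₀ rfl
  set g : X → ℝ := fun x => max 0 (dist x x₀ - (R + 1))
  have hg0 : ∀ x, 0 ≤ g x := fun x => le_max_left _ _
  have hg : ∀ x y, g x ≤ g y + dist x y := fun x y => by
    refine max_le (add_nonneg (hg0 y) dist_nonneg) ?_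
    linarith [dist_triangle x y x₀, le_max_right 0 (dist y x₀ - (R + 1))]
  set e : X → X → ℝ := fun x y => min (dist x y) (g x + g y)
  have hetri : ∀ x y z, e x z ≤ e x y + e y z := min_dist_add_triangle hg0 hg
  have hcollapse : ∀ B : Set X, IsBounded B → ∃ N : ℕ, ∀ w : List I, N ≤ w.length →
      ∀ x ∈ B, ∀ y ∈ B, e (wordComp f w x) (wordComp f w y) = 0 := by
    intro B hB
    obtain ⟨C, hC⟩ := isBounded_iff.1 (hB.insert x₀)
    obtain ⟨M, hBM, -, -, hM⟩ := hf (insert x₀ B) ⟨C, fun x hx y hy => hC hx hy⟩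
    obtain ⟨N, hN⟩ := hM 1 one_pos
    have hgz : ∀ w : List I, N ≤ w.length → ∀ x ∈ B, g (wordComp f w x) = 0 := by
      intro w hw x hx
      refine max_eq_left ?_
      linarith [hN w hw x (hBM (mem_insert_of_mem _ hx)) x₀ (hBM (mem_insert _ _)),
        hR _ (mapsTo_wordComp hM₀ w hx₀) x₀ hx₀,
        dist_triangle (wordComp f w x) (wordComp f w x₀) x₀]
    refine ⟨N, fun w hw x hx y hy => ?_⟩
    simp [e, hgz w hw x hx, hgz w hw y hy, dist_nonneg]
  set c : ℕ → ℝ := fun n => 2 - (1 / 2) ^ n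
  have hc1 : ∀ n, 1 ≤ c n := fun n => by
    have : ((1 : ℝ) / 2) ^ n ≤ 1 := pow_le_one₀ (by norm_num) (by norm_num)
    simp only [c]; linarith
  have hc2 : ∀ n, c n ≤ 2 := fun n => by
    have : (0 : ℝ) < (1 / 2) ^ n := by positivity
    simp only [c]; linarith
  have hcontr : ∀ ρ : X → X → ℝ,
      (∀ w x y, max (c w.length * dist (wordComp f w x) (wordComp f w y))
        (2 ^ w.length * e (wordComp f w x) (wordComp f w y)) ≤ ρ x y) →
      (∀ x y b, (∀ w, max (c w.length * dist (wordComp f w x) (wordComp f w y))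
        (2 ^ w.length * e (wordComp f w x) (wordComp f w y)) ≤ b) → ρ x y ≤ b) →
      ∀ s > 0, ∃ s' > s, ∃ r < s, ∀ x y i, ρ x y < s' → ρ (f i x) (f i y) ≤ r := by
    intro ρ hle hsup s hs
    have hlong : ∃ L : ℕ, ∀ x y, ρ x y ≤ 2 * s → ∀ w : List I, L ≤ w.length →
        dist (wordComp f w x) (wordComp f w y) ≤ s / 4 := by
      have hτ : 0 < min (s / 4) 1 := lt_min (by linarith) one_pos
      obtain ⟨K, hK⟩ := pow_unbounded_of_one_lt (2 * s / min (s / 4) 1) (one_lt_two : (1 : ℝ) < 2)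
      rw [div_lt_iff₀ hτ] at hK
      obtain ⟨M, hVM, -, -, hM⟩ := hf (closedBall x₀ (R + 2)) ⟨2 * (R + 2), fun x hx y hy => by
        linarith [dist_triangle_right x y x₀, mem_closedBall.1 hx, mem_closedBall.1 hy]⟩
      obtain ⟨N, hN⟩ := hM (s / 4) (by linarith)
      refine ⟨K + N, fun x y hxy w hw => ?_⟩
      by_contra! hfar
      set v := w.take (w.length - K)
      set u := w.drop (w.length - K)
      have hu : u.length = K := by simp [u]; omega
      have hv : N ≤ v.length := by simp [v]; omega
      have hvu : v ++ u = w := List.take_append_drop _ _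
      rw [← hvu, wordComp_append, wordComp_append] at hfar
      have hd := hfar.trans_le (dist_wordComp_le_of_nonexpansive hne v _ _)
      have hQ := ((le_max_right _ _).trans (hle u x y)).trans hxy
      rw [hu] at hQ
      have hlt : e (wordComp f u x) (wordComp f u y) < min (s / 4) 1 :=
        lt_of_mul_lt_mul_left (hQ.trans_lt hK) (by positivity)
      have hg1 : g (wordComp f u x) + g (wordComp f u y) < 1 := by
        rcases min_lt_iff.1 hlt with h | h
        · exact absurd (h.trans_le (min_le_left _ _)) hd.not_gt
        · exact h.trans_le (min_le_right _ _)
      have hball : ∀ z, g z < 1 → z ∈ closedBall x₀ (R + 2) := fun z hz => by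
        rw [mem_closedBall]
        linarith [le_max_right 0 (dist z x₀ - (R + 1))]
      exact absurd (hN v hv _ (hVM (hball _ (by linarith [hg0 (wordComp f u y)]))) _
        (hVM (hball _ (by linarith [hg0 (wordComp f u x)])))) hfar.not_ge
    obtain ⟨L, hL⟩ := hlong
    set η : ℝ := (1 / 2) ^ (L + 2)
    have hη0 : 0 < η := by positivity
    have hη1 : η ≤ 1 / 4 := by
      have : ((1 : ℝ) / 2) ^ L ≤ 1 := pow_le_one₀ (by norm_num) (by norm_num)
      simp only [η, pow_add]; linarith
    have hcq : ∀ n ≤ L, c n ≤ (1 - η) * c (n + 1) := by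
      intro n hn
      have h₁ : ((1 : ℝ) / 2) ^ L ≤ (1 / 2) ^ n :=
        pow_le_pow_of_le_one (by norm_num) (by norm_num) hn
      have h₂ : η * c (n + 1) ≤ η * 2 := mul_le_mul_of_nonneg_left (hc2 _) hη0.le
      have h₃ : η = (1 / 2) ^ L / 4 := by simp only [η, pow_add]; ring
      have h₄ : c (n + 1) = c n + (1 / 2) ^ n / 2 := by simp only [c, pow_succ]; ring
      have h₅ : (1 - η) * c (n + 1) = c (n + 1) - η * c (n + 1) := by ring
      linarith
    have hs' : (1 - η) * (s * (1 + η)) < s := by nlinarith [mul_pos hs (mul_pos hη0 hη0)]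
    have hgt : s < s * (1 + η) := by nlinarith [mul_pos hs hη0]
    have h2s : s * (1 + η) ≤ 2 * s := by nlinarith
    have hhalf : s ≤ 2 * ((1 - η) * (s * (1 + η))) := by
      nlinarith [mul_pos hs hη0, mul_nonneg hs.le (mul_nonneg hη0.le (sub_nonneg.2 hη1))]
    refine ⟨s * (1 + η), hgt, (1 - η) * (s * (1 + η)), hs', fun x y i hxy =>
      hsup _ _ _ fun w => ?_⟩
    have hw := (hle (w ++ [i]) x y).trans hxy.le
    rw [wordComp_concat, wordComp_concat, List.length_append, List.length_singleton] at hw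
    refine max_le ?_ ?_
    · rcases le_or_gt w.length L with hlen | hlen
      · calc c w.length * dist (wordComp f w (f i x)) (wordComp f w (f i y))
            ≤ (1 - η) * c (w.length + 1) * dist (wordComp f w (f i x)) (wordComp f w (f i y)) :=
              mul_le_mul_of_nonneg_right (hcq _ hlen) dist_nonneg
          _ = (1 - η) *
              (c (w.length + 1) * dist (wordComp f w (f i x)) (wordComp f w (f i y))) := by ring
          _ ≤ _ := mul_le_mul_of_nonneg_left ((le_max_left _ _).trans hw) (by linarith)
      · have h₁ := hL x y (hxy.le.trans h2s) (w ++ [i]) (by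
          rw [List.length_append]; omega)
        rw [wordComp_concat, wordComp_concat] at h₁
        have h₂ := mul_le_mul (hc2 w.length) h₁ dist_nonneg zero_le_two
        linarith
    · have h₁ := (le_max_right _ _).trans hw
      rw [pow_succ] at h₁
      have h₂ : s * (1 + η) ≤ 2 * ((1 - η) * (s * (1 + η))) := by
        nlinarith [mul_pos hs hη0]
      linarith
  obtain ⟨m₁, htop, hcomplete, -, hle, hsup⟩ :=
    exists_metricSpace_iSup hcont (fun n x y => max (c n * dist x y) (2 ^ n * e x y))
      (fun n x => by simp [e, hg0 x])
      (fun n x y => by simp only [e, dist_comm x y, add_comm (g x)])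
      (fun n x y z => by
        refine max_le ?_ ?_
        · refine le_trans ?_ (add_le_add (le_max_left _ _) (le_max_left _ _))
          rw [← mul_add]
          exact mul_le_mul_of_nonneg_left (dist_triangle x y z) (zero_le_one.trans (hc1 n))
        · refine le_trans ?_ (add_le_add (le_max_right _ _) (le_max_right _ _))
          rw [← mul_add]
          exact mul_le_mul_of_nonneg_left (hetri x y z) (by positivity))
      (fun x y => le_max_of_le_left (by norm_num [c]))
      (fun n x => by
        have : Continuous fun y => max (c n * dist x y) (2 ^ n * e x y) := by fun_prop
        simpa [e, hg0 x] using this.tendsto x)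
      (fun B hB ε hε => by
        obtain ⟨C, hC⟩ := isBounded_iff.1 hB
        obtain ⟨M, hBM, -, -, hM⟩ := hf B ⟨C, fun x hx y hy => hC hx hy⟩
        obtain ⟨N, hN⟩ := hM (ε / 2) (half_pos hε)
        obtain ⟨N', hN'⟩ := hcollapse B hB
        refine ⟨max N N', fun w hw x hx y hy => max_le ?_ ?_⟩
        · have h₁ := hN w ((le_max_left _ _).trans hw) x (hBM hx) y (hBM hy)
          have h₂ := mul_le_mul (hc2 w.length) h₁ dist_nonneg zero_le_two
          linarith
        · rw [hN' w ((le_max_right _ _).trans hw) x hx y hy, mul_zero]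
          exact hε.le)
  exact ⟨m₁, htop, hcomplete, hcontr _ hle hsup⟩

/-- **Theorem 4.1, equivalence of 1 and 4.** For an IFS `S = ((X,d),(f_i))`, the following are
equivalent: (1) there are a comparison function `φ` and a metric `d₁` on `X`, topologically
equivalent to `d` and complete, such that `((X,d₁),(f_i))` is a `φ`-contractive IFS;
(4) there is a metric `d₁` on `X`, topologically equivalent to `d` and complete, such that
`((X,d₁),(f_i))` is a diameter diminishing to zero IFS. -/
theorem hyperbolic_phi_contractive_iff_hyperbolic_ddz {X I : Type*} [m : MetricSpace X]
    [CompleteSpace X] [Finite I] [Nonempty I] (f : I → X → X)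
    (hcont : ∀ i, Continuous (f i))
    (hbdd : BoundedPreserving f) :
    (∃ φ : ℝ → ℝ, IsComparisonFn φ ∧
      ∃ m₁ : MetricSpace X,
        m₁.toUniformSpace.toTopologicalSpace = m.toUniformSpace.toTopologicalSpace ∧
        @CompleteSpace X m₁.toUniformSpace ∧
        @BoundedPreserving X I m₁ f ∧
        @IsPhiContractive X I m₁ φ f) ↔
    (∃ m₁ : MetricSpace X,
      m₁.toUniformSpace.toTopologicalSpace = m.toUniformSpace.toTopologicalSpace ∧
      @CompleteSpace X m₁.toUniformSpace ∧
      @BoundedPreserving X I m₁ f ∧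
      @IsDDZ X I m₁ f) := by
  constructor
  · rintro ⟨φ, hφ, m₁, htop, hcomplete, hb, hf⟩
    exact ⟨m₁, htop, hcomplete, hb, @IsPhiContractive.isDDZ X I m₁ φ f _ hφ hf⟩
  · rintro ⟨m₁, htop₁, hcomplete₁, -, hddz⟩
    have hcont₁ : ∀ i, @Continuous X X m₁.toUniformSpace.toTopologicalSpace
        m₁.toUniformSpace.toTopologicalSpace (f i) := by
      rw [htop₁]
      exact hcont
    obtain ⟨m₂, htop₂, hcomplete₂, hdim, hne⟩ :=
      @UniformlyDiminishing.exists_nonexpansive X I m₁ hcomplete₁ _ f hcont₁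
        (@IsDDZ.uniformlyDiminishing X I m₁ _ f hddz)
    obtain ⟨m₃, htop₃, hcomplete₃, hcontr⟩ :=
      @UniformlyDiminishing.exists_contractive X I m₂ hcomplete₂ _ f hdim hne
    obtain ⟨φ, hφ, hf⟩ := @exists_isComparisonFn X I m₃ f hcontr
    exact ⟨φ, hφ, m₃, htop₃.trans (htop₂.trans htop₁), hcomplete₃,
      @IsPhiContractive.boundedPreserving X I m₃ φ f hφ hf, hf⟩
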